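/- arXiv:1709.04567 — 4 statements merged into one kernel-verified Lean document; each statement's English description precedes it below -/
import Mathlib

section
/- Suppose for each n ∈ ω we are given a function f_n : [2^ω]ⁿ_= → 2^ω defined on the injective n-tuples from Cantor space, and suppose each f_n is Baire measurable, i.e., for every open U ⊆ 2^ω the preimage f_n⁻¹[U] has the Baire property as a subset of (2^ω)ⁿ. Then there exist a set Y ⊆ 2^ω in bijection with 2^ω (indeed a nonempty perfect subset of 2^ω) and a point z ∈ 2^ω such that for every n ∈ ω and every injective n-tuple (y_0,…,y_{n−1}) of elements of Y, f_n(y_0,…,y_{n−1}) ≠ z. (This is the content of the Holshouser–Jackson theorem that, if all sets of reals have the Baire property, 2^ω has the Jónsson property.) -/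
open Set Function

/-- A subset of a topological space has the Baire property iff its symmetric difference with
some open set is meager. -/
def HasBaireProperty {X : Type*} [TopologicalSpace X] (s : Set X) : Prop :=
  ∃ u : Set X, IsOpen u ∧ IsMeagre (symmDiff s u)

/-- Precomposition with an injective map is open for the product topologies. -/
theorem isOpenMap_precomp_of_injective {ι κ X : Type*} [TopologicalSpace X] {τ : κ → ι}
    (hτ : Injective τ) : IsOpenMap fun y : ι → X => y ∘ τ := by
  refine IsOpenMap.of_sections fun y => ⟨fun t => extend τ t y, ?_, ?_, fun t => ?_⟩
  · refine Continuous.continuousAt (continuous_pi fun s => ?_)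
    by_cases h : ∃ i, τ i = s
    · obtain ⟨i, rfl⟩ := h
      simpa only [hτ.extend_apply] using continuous_apply i
    · simpa only [extend_apply' _ _ _ h] using continuous_const
  · funext s
    by_cases h : ∃ i, τ i = s
    · obtain ⟨i, rfl⟩ := h
      simp [hτ.extend_apply]
    · simp [extend_apply' _ _ _ h]
  · exact extend_comp hτ t y

/-- Restricting finitely many distinct sequences to a long enough initial segment keeps them
distinct. -/
theorem eventually_injective_restrict {ι α : Type*} [Finite ι] {x : ι → ℕ → α}
    (hx : Injective x) :
    ∀ᶠ k in Filter.atTop, Injective fun (i : ι) (m : Fin k) => x i m := by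
  have h : ∀ i i' : ι, ∀ᶠ k in Filter.atTop,
      (fun m : Fin k => x i m) = (fun m : Fin k => x i' m) → i = i' := by
    intro i i'
    by_cases hii : i = i'
    · exact Filter.Eventually.of_forall fun _ _ => hii
    · obtain ⟨m, hm⟩ := Function.ne_iff.1 (hx.ne hii)
      filter_upwards [Filter.eventually_gt_atTop m] with k hk hEq
      exact absurd (congrFun hEq ⟨m, hk⟩) hm
  filter_upwards [Filter.eventually_all.2 fun i => Filter.eventually_all.2 (h i)] with k hk i i' hi
  exact hk i i' hi

/-- A neighbourhood of a finite tuple of sequences contains a product of cylinders of a common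
length, which may be taken as large as desired. -/
theorem exists_cylinder_pi_subset {ι α : Type*} [Finite ι] [TopologicalSpace α]
    [DiscreteTopology α] {E : Set (ι → ℕ → α)} (hE : IsOpen E) {y : ι → ℕ → α} (hy : y ∈ E)
    (l : ℕ) : ∃ l' > l, ∀ w : ι → ℕ → α, (∀ i, w i ∈ PiNat.cylinder (y i) l') → w ∈ E := by
  obtain ⟨u, hu, hus⟩ := isOpen_pi_iff'.1 hE y hy
  have h : ∀ i, ∃ m, PiNat.cylinder (y i) m ⊆ u i := fun i => by
    obtain ⟨v, ⟨z, m, rfl⟩, hv, hvu⟩ :=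
      (PiNat.isTopologicalBasis_cylinders fun _ : ℕ => α).exists_subset_of_mem_open
        (hu i).2 (hu i).1
    exact ⟨m, by rwa [PiNat.mem_cylinder_iff_eq.1 hv]⟩
  choose m hm using h
  obtain ⟨M, hM⟩ := (Set.finite_range m).bddAbove
  refine ⟨max M l + 1, by omega, fun w hw => hus fun i _ => hm i ?_⟩
  have : m i ≤ max M l + 1 := ((hM ⟨i, rfl⟩).trans (le_max_left _ _)).trans (Nat.le_succ _)
  exact PiNat.cylinder_anti _ this (hw i)

/-- One step of the fusion: finitely many cylinders can be split in two and then shrunk so that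
the product of the resulting cylinders lies in a given dense open set. -/
theorem exists_fusion_step {k : ℕ} {E : Set ((Fin (k + 1) → Bool) → ℕ → Bool)} (hE : IsOpen E)
    (hd : Dense E) (S : ((Fin k → Bool) → ℕ → Bool) × ℕ) :
    ∃ S' : ((Fin (k + 1) → Bool) → ℕ → Bool) × ℕ, S.2 < S'.2 ∧
      (∀ s, S'.1 s ∈ PiNat.cylinder (S.1 fun i => s i.castSucc) S.2) ∧
      ∀ w : (Fin (k + 1) → Bool) → ℕ → Bool,
        (∀ s, w s ∈ PiNat.cylinder (S'.1 s) S'.2) → w ∈ E := by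
  have hopen : IsOpen (Set.univ.pi fun s : Fin (k + 1) → Bool =>
      PiNat.cylinder (S.1 fun i => s i.castSucc) S.2) :=
    isOpen_set_pi Set.finite_univ fun s _ => PiNat.isOpen_cylinder _ _ _
  obtain ⟨y, hy, hyE⟩ := hd.inter_open_nonempty _ hopen
    ⟨fun s => S.1 fun i => s i.castSucc, fun s _ => PiNat.self_mem_cylinder _ _⟩
  obtain ⟨l', hl', h⟩ := exists_cylinder_pi_subset hE hyE S.2
  exact ⟨(y, l'), hl', fun s => hy s trivial, h⟩

/-- Fusion: dense open sets of `2 ^ k`-tuples of points of Cantor space are met simultaneously by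
one continuous map, in the sense that each contains a product of neighbourhoods of the images. -/
theorem exists_continuous_fusion (E : ∀ k : ℕ, Set ((Fin (k + 1) → Bool) → ℕ → Bool))
    (hE : ∀ k, IsOpen (E k)) (hd : ∀ k, Dense (E k)) :
    ∃ φ : (ℕ → Bool) → ℕ → Bool, Continuous φ ∧
      ∀ (k : ℕ) (ι : Type) (x : ι → ℕ → Bool) (τ : ι → Fin (k + 1) → Bool), Injective τ →
        (∀ i (m : Fin (k + 1)), τ i m = x i m) → ∃ w ∈ E k, w ∘ τ = φ ∘ x := by
  choose step hlt hcyl hmem using fun (k : ℕ) (S : ((Fin k → Bool) → ℕ → Bool) × ℕ) =>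
    exists_fusion_step (hE k) (hd k) S
  let S : ∀ k : ℕ, ((Fin k → Bool) → ℕ → Bool) × ℕ :=
    fun k => Nat.rec (fun _ _ => false, 0) (fun k S => step k S) k
  have hlen : ∀ k, k ≤ (S k).2 := fun k => by
    induction k with
    | zero => exact Nat.zero_le _
    | succ k ih => exact ih.trans_lt (hlt k (S k))
  let p : ℕ → (ℕ → Bool) → ℕ → Bool := fun k x => (S k).1 fun i => x i
  have hstep : ∀ k x j, j < (S k).2 → p (k + 1) x j = p k x j :=
    fun k x j hj => hcyl k (S k) (fun i => x i) j hj
  have hmono : Monotone fun k => (S k).2 := monotone_nat_of_le_succ fun k => (hlt k (S k)).le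
  have hstable : ∀ k k' x j, k ≤ k' → j < (S k).2 → p k' x j = p k x j := by
    intro k k' x j hk hj
    induction k', hk using Nat.le_induction with
    | base => rfl
    | succ k' hk ih => exact (hstep k' x j (hj.trans_le (hmono hk))).trans ih
  let φ : (ℕ → Bool) → ℕ → Bool := fun x j => p (j + 1) x j
  have hφ : ∀ k x, φ x ∈ PiNat.cylinder (p k x) (S k).2 := by
    intro k x j hj
    rcases le_total k (j + 1) with h | h
    · exact hstable k (j + 1) x j h hj
    · exact (hstable (j + 1) k x j h (hlen (j + 1))).symm
  refine ⟨φ, continuous_pi fun j => ?_, fun k ι x τ hτ hx => ?_⟩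
  · have : Continuous fun (x : ℕ → Bool) (i : Fin (j + 1)) => x i :=
      continuous_pi fun i => continuous_apply _
    exact (continuous_of_discreteTopology
      (f := fun s : Fin (j + 1) → Bool => (S (j + 1)).1 s j)).comp this
  · refine ⟨extend τ (φ ∘ x) (S (k + 1)).1, hmem k (S k) _ fun s => ?_, extend_comp hτ _ _⟩
    by_cases h : ∃ i, τ i = s
    · obtain ⟨i, rfl⟩ := h
      rw [hτ.extend_apply]
      have hτi : τ i = fun m : Fin (k + 1) => x i m := funext (hx i)
      rw [hτi]
      exact hφ (k + 1) (x i)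
    · rw [extend_apply' _ _ _ h]
      exact PiNat.self_mem_cylinder _ _

/-- A residual set contains the intersection of a sequence of dense open sets. -/
theorem exists_seq_isOpen_dense_of_mem_residual {X : Type*} [TopologicalSpace X] [BaireSpace X]
    {G : Set X} (hG : G ∈ residual X) :
    ∃ D : ℕ → Set X, (∀ j, IsOpen (D j)) ∧ (∀ j, Dense (D j)) ∧ ⋂ j, D j ⊆ G := by
  obtain ⟨t, htG, ht, htd⟩ := mem_residual.1 hG
  obtain ⟨D, hD, rfl⟩ := ht.eq_iInter_nat
  exact ⟨D, hD, fun j => htd.mono (Set.iInter_subset _ j), htG⟩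

/-- Parametrized form of Mycielski's theorem for Cantor space. -/
theorem exists_continuous_forall_injective_comp_mem (G : ∀ n : ℕ, Set (Fin n → ℕ → Bool))
    (hG : ∀ n, G n ∈ residual (Fin n → ℕ → Bool)) :
    ∃ φ : (ℕ → Bool) → ℕ → Bool, Continuous φ ∧
      ∀ (n : ℕ) (x : Fin n → ℕ → Bool), Injective x → φ ∘ x ∈ G n := by
  choose D hDo hDd hDG using fun n => exists_seq_isOpen_dense_of_mem_residual (hG n)
  let E : ∀ k : ℕ, Set ((Fin (k + 1) → Bool) → ℕ → Bool) := fun k =>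
    ⋂ (n : Fin (k + 1)) (j : Fin (k + 1)) (τ : {τ : Fin n → Fin (k + 1) → Bool // Injective τ}),
      (fun y => y ∘ τ.1) ⁻¹' D n j
  have hcont : ∀ {ι κ : Type} (τ : κ → ι), Continuous fun y : ι → ℕ → Bool => y ∘ τ :=
    fun τ => continuous_pi fun i => continuous_apply (τ i)
  have hEo : ∀ k, IsOpen (E k) := fun k =>
    isOpen_iInter_of_finite fun n => isOpen_iInter_of_finite fun j =>
      isOpen_iInter_of_finite fun τ => (hDo n j).preimage (hcont τ.1)
  have hEd : ∀ k, Dense (E k) := fun k => by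
    refine dense_of_mem_residual ?_
    refine countable_iInter_mem.2 fun n => countable_iInter_mem.2 fun j =>
      countable_iInter_mem.2 fun τ => ?_
    exact tendsto_residual_of_isOpenMap (hcont τ.1) (isOpenMap_precomp_of_injective τ.2)
      (residual_of_dense_open (hDo n j) (hDd n j))
  obtain ⟨φ, hφ, h⟩ := exists_continuous_fusion E hEo hEd
  refine ⟨φ, hφ, fun n x hx => hDG n (Set.mem_iInter.2 fun j => ?_)⟩
  obtain ⟨k, hk, hnk, hjk⟩ := (((Filter.tendsto_add_atTop_nat 1).eventually
    (eventually_injective_restrict hx)).and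
      ((Filter.eventually_ge_atTop n).and (Filter.eventually_ge_atTop j))).exists
  obtain ⟨w, hw, hwx⟩ := h k (Fin n) x _ hk fun _ _ => rfl
  rw [← hwx]
  simp only [E, Set.mem_iInter] at hw
  exact hw ⟨n, Nat.lt_succ_of_le hnk⟩ ⟨j, Nat.lt_succ_of_le hjk⟩ ⟨_, hk⟩

/-- The range of a continuous injection from a compact space without isolated points into
a Hausdorff space is perfect. -/
theorem perfect_range_of_continuous_injective {X Z : Type*} [TopologicalSpace X] [CompactSpace X]
    [PerfectSpace X] [TopologicalSpace Z] [T2Space Z] {φ : X → Z} (hφ : Continuous φ)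
    (hinj : Injective φ) : Perfect (Set.range φ) := by
  refine ⟨(isCompact_range hφ).isClosed, ?_⟩
  rintro _ ⟨x, rfl⟩
  have hx : AccPt x (Filter.principal Set.univ) := PerfectSpace.univ_preperfect x trivial
  simpa using hx.map hφ.continuousAt hinj

/-- **Mycielski's theorem** for Cantor space: given residual sets of `n`-tuples for every `n`,
there is a nonempty perfect set all of whose injective tuples lie in them. -/
theorem exists_perfect_forall_injective_mem (G : ∀ n : ℕ, Set (Fin n → ℕ → Bool))
    (hG : ∀ n, G n ∈ residual (Fin n → ℕ → Bool)) :
    ∃ Y : Set (ℕ → Bool), Perfect Y ∧ Y.Nonempty ∧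
      ∀ (n : ℕ) (t : Fin n → ℕ → Bool), Injective t → (∀ i, t i ∈ Y) → t ∈ G n := by
  have hdist : {t : Fin 2 → ℕ → Bool | t 0 ≠ t 1} ∈ residual (Fin 2 → ℕ → Bool) := by
    have hopen : IsOpen {t : Fin 2 → ℕ → Bool | t 0 ≠ t 1} :=
      isOpen_ne_fun (continuous_apply 0) (continuous_apply 1)
    refine residual_of_dense_open hopen fun t => ?_
    by_cases ht : t 0 = t 1
    · refine mem_closure_iff.2 fun o ho hto => ?_
      obtain ⟨l, -, h⟩ := exists_cylinder_pi_subset ho hto 0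
      refine ⟨update t 0 (update (t 0) l (!t 0 l)), h _ fun i => ?_, fun heq => ?_⟩
      · fin_cases i
        · intro j hj
          simp [hj.ne]
        · exact PiNat.self_mem_cylinder _ _
      · have := congrFun heq l
        simp [← ht] at this
    · exact subset_closure ht
  have hinj : ∀ n, {t : Fin n → ℕ → Bool | ∀ h : n = 2, t (Fin.cast h.symm 0) ≠
      t (Fin.cast h.symm 1)} ∈ residual (Fin n → ℕ → Bool) := by
    intro n
    by_cases h : n = 2
    · subst h
      filter_upwards [hdist] with t ht _
      exact ht
    · exact Filter.Eventually.of_forall fun t h' => absurd h' h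
  obtain ⟨φ, hφ, h⟩ := exists_continuous_forall_injective_comp_mem _
    fun n => Filter.inter_mem (hG n) (hinj n)
  have hφinj : Injective φ := by
    intro a b hab
    by_contra hne
    have hx : Injective ![a, b] := by
      intro i j hij
      fin_cases i <;> fin_cases j <;> simp_all [eq_comm]
    exact (h 2 ![a, b] hx).2 rfl hab
  have hperf : PerfectSpace (ℕ → Bool) := by
    refine ⟨preperfect_iff_nhds.2 fun x _ U hU => ?_⟩
    obtain ⟨v, ⟨y, l, rfl⟩, hv, hvU⟩ :=
      (PiNat.isTopologicalBasis_cylinders fun _ : ℕ => Bool).mem_nhds_iff.1 hU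
    rw [← PiNat.mem_cylinder_iff_eq.1 hv] at hvU
    refine ⟨update x l (!x l), ⟨hvU (PiNat.update_mem_cylinder _ _ _), trivial⟩, fun heq => ?_⟩
    simpa using congrFun heq l
  refine ⟨Set.range φ, perfect_range_of_continuous_injective hφ hφinj, Set.range_nonempty φ,
    fun n t ht htY => ?_⟩
  choose x hx using htY
  obtain rfl : φ ∘ x = t := funext hx
  exact (h n x ht.of_comp).1

/-- All but countably many fibres of a map whose fibres have the Baire property are meagre. -/
theorem countable_setOf_not_isMeagre {X Z : Type*} [TopologicalSpace X] [BaireSpace X]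
    [TopologicalSpace.SeparableSpace X] {A : Z → Set X} (hA : ∀ z, BaireMeasurableSet (A z))
    (hdisj : Pairwise (Disjoint on A)) : {z | ¬ IsMeagre (A z)}.Countable := by
  choose U hUo hAU using fun z => (hA z).residualEq_isOpen
  refine Set.PairwiseDisjoint.countable_of_isOpen (s := U) ?_ (fun z _ => hUo z) ?_
  · intro z _ z' _ hzz
    refine Set.disjoint_iff_inter_eq_empty.2 ?_
    have h : (U z ∩ U z' : Set X) =ᶠ[residual X] (∅ : Set X) := by
      have := (hAU z).symm.inter (hAU z').symm
      rwa [Set.disjoint_iff_inter_eq_empty.1 (hdisj hzz)] at this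
    by_contra hne
    have hd : Dense (U z ∩ U z')ᶜ :=
      dense_of_mem_residual (Filter.eventuallyEq_empty.1 h)
    obtain ⟨a, ha, ha'⟩ := hd.inter_open_nonempty _ ((hUo z).inter (hUo z'))
      (Set.nonempty_iff_ne_empty.2 hne)
    exact ha' ha
  · intro z hz
    by_contra hne
    rw [Set.not_nonempty_iff_eq_empty] at hne
    have := hAU z
    rw [hne] at this
    exact hz (Filter.eventuallyEq_empty.1 this)

/-- A set with the Baire property is Baire measurable. -/
theorem HasBaireProperty.baireMeasurableSet {X : Type*} [TopologicalSpace X] {s : Set X}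
    (hs : HasBaireProperty s) : BaireMeasurableSet s := by
  obtain ⟨u, hu, h⟩ := hs
  refine hu.baireMeasurableSet.congr (Filter.eventuallyEq_set.2 ?_)
  filter_upwards [h] with x hx
  simp only [Set.mem_compl_iff, Set.mem_symmDiff] at hx
  tauto

/-- (Holshouser–Jackson) If every function `f n` on injective `n`-tuples from Cantor space is
Baire measurable, then there is a nonempty perfect set `Y ⊆ 2^ω` (hence `Y ≈ 2^ω`) and a point
`z` omitted by every `f n` on injective tuples from `Y`: Cantor space has the Jónsson property. -/
theorem cantor_jonsson_of_baire_measurable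
    (f : ∀ n : ℕ, (Fin n → (ℕ → Bool)) → (ℕ → Bool))
    (hf : ∀ (n : ℕ) (U : Set (ℕ → Bool)), IsOpen U →
      HasBaireProperty {t : Fin n → (ℕ → Bool) | Function.Injective t ∧ f n t ∈ U}) :
    ∃ Y : Set (ℕ → Bool), Perfect Y ∧ Y.Nonempty ∧
      ∃ z : ℕ → Bool, ∀ (n : ℕ) (t : Fin n → (ℕ → Bool)),
        Function.Injective t → (∀ i, t i ∈ Y) → f n t ≠ z := by
  let A : ∀ n : ℕ, (ℕ → Bool) → Set (Fin n → ℕ → Bool) :=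
    fun n z => {t | Injective t ∧ f n t = z}
  have hA : ∀ n z, BaireMeasurableSet (A n z) := by
    intro n z
    have : A n z = ⋂ k : ℕ, {t | Injective t ∧ f n t ∈ PiNat.cylinder z k} := by
      ext t
      simp only [A, Set.mem_ofPred_eq, Set.mem_iInter]
      refine ⟨fun h k => ⟨h.1, h.2 ▸ PiNat.self_mem_cylinder _ _⟩, fun h => ⟨(h 0).1, ?_⟩⟩
      funext j
      exact (h (j + 1)).2 j (Nat.lt_succ_self j)
    rw [this]
    exact BaireMeasurableSet.iInter fun k =>
      (hf n _ (PiNat.isOpen_cylinder _ _ _)).baireMeasurableSet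
  have hcount : (⋃ n, {z | ¬ IsMeagre (A n z)}).Countable :=
    Set.countable_iUnion fun n => countable_setOf_not_isMeagre (hA n) fun z z' hzz =>
      Set.disjoint_left.2 fun t ht ht' => hzz (ht.2.symm.trans ht'.2)
  have hunc : ¬ (Set.univ : Set (ℕ → Bool)).Countable := by
    rw [Set.countable_univ_iff, ← Cardinal.mk_le_aleph0_iff, not_le]
    simpa using Cardinal.cantor Cardinal.aleph0
  obtain ⟨z, hz⟩ : ∃ z, z ∉ ⋃ n, {z | ¬ IsMeagre (A n z)} := by
    by_contra! h
    exact hunc (hcount.mono fun z _ => h z)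
  simp only [Set.mem_iUnion, Set.mem_ofPred_eq, not_exists, not_not] at hz
  obtain ⟨Y, hY, hne, h⟩ := exists_perfect_forall_injective_mem (fun n => (A n z)ᶜ) hz
  exact ⟨Y, hY, hne, z, fun n t ht htY hft => h n t ht htY ⟨ht, hft⟩⟩
end

section
/- There exists a function Φ from the collection of countably infinite subsets of 2^ω to 2^ω such that for every uncountable set B ⊆ 2^ω, the image under Φ of the collection of countably infinite subsets of B is all of 2^ω. In particular, 2^ω has a classical ω-Jónsson function: a map Φ : P^ω(2^ω) → 2^ω such that Φ[P^ω(Y)] = 2^ω for every Y ⊆ 2^ω in bijection with 2^ω. -/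
open Set

open Filter Topology

/-- The points of `S` other than `x` whose first difference from `x` occurs at position `n`. -/
def splittingAt (x : ℕ → Bool) (S : Set (ℕ → Bool)) (n : ℕ) : Set (ℕ → Bool) :=
  {y ∈ S | x ≠ y ∧ PiNat.firstDiff (E := fun _ => Bool) x y = n}

/-- Enumerate the positions at which points of `S` split from `x`, and record at which of them
more than one point splits. -/
noncomputable def splittingCode (x : ℕ → Bool) (S : Set (ℕ → Bool)) (k : ℕ) : Bool :=
  open Classical in
  decide (splittingAt x S (Nat.nth (fun n => (splittingAt x S n).Nonempty) k)).Nontrivial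

theorem exists_condensation_point {X : Type*} [TopologicalSpace X] [SecondCountableTopology X]
    {B : Set X} (hB : ¬B.Countable) : ∃ x ∈ B, ∀ U ∈ 𝓝 x, ¬(U ∩ B).Countable := by
  by_contra! h
  choose! U hU hc using h
  obtain ⟨t, ht, htc, hBt⟩ := TopologicalSpace.countable_cover_nhdsWithin
    (fun x hx => mem_nhdsWithin_of_mem_nhds (hU x hx))
  refine hB ((htc.biUnion fun x hx => hc x (ht hx)).mono fun y hy => ?_)
  obtain ⟨x, hx, hyx⟩ := mem_iUnion₂.1 (hBt hy)
  exact mem_iUnion₂.2 ⟨x, hx, hyx, hy⟩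

theorem cylinder_mem_nhds (x : ℕ → Bool) (N : ℕ) :
    PiNat.cylinder (E := fun _ => Bool) x N ∈ 𝓝 x :=
  (PiNat.isOpen_cylinder (fun _ => Bool) x N).mem_nhds (PiNat.self_mem_cylinder x N)

theorem infinite_setOf_splittingAt_nontrivial {x : ℕ → Bool} {B : Set (ℕ → Bool)}
    (hx : ∀ U ∈ 𝓝 x, ¬(U ∩ B).Countable) : {n | (splittingAt x B n).Nontrivial}.Infinite := by
  intro hfin
  obtain ⟨N, hN⟩ := hfin.bddAbove
  refine hx _ (cylinder_mem_nhds x (N + 1)) ?_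
  have hc : ({x} ∪ ⋃ n ∈ Ioi N, splittingAt x B n).Countable := by
    refine (countable_singleton x).union ((to_countable _).biUnion fun n hn => ?_)
    refine Subsingleton.countable (not_nontrivial_iff.1 fun h => ?_)
    exact absurd (hN h) (not_le.2 hn)
  refine hc.mono fun y hy => ?_
  by_cases hxy : x = y
  · exact Or.inl hxy.symm
  · refine Or.inr (mem_iUnion₂.2 ⟨_, ?_, hy.2, hxy, rfl⟩)
    exact (PiNat.mem_cylinder_iff_le_firstDiff hxy (N + 1)).1
      ((PiNat.mem_cylinder_comm _ _ _).1 hy.1)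

theorem exists_splittingCode_eq {x : ℕ → Bool} {B : Set (ℕ → Bool)}
    (hx : {n | (splittingAt x B n).Nontrivial}.Infinite) (z : ℕ → Bool) :
    ∃ A ⊆ B, A.Countable ∧ A.Infinite ∧ Tendsto id (cofinite ⊓ 𝓟 A) (𝓝 x) ∧
      splittingCode x A = z := by
  set e := Nat.nth fun n => (splittingAt x B n).Nontrivial with he
  have hmono : StrictMono e := Nat.nth_strictMono hx
  choose a ha b hb hab using fun k => (Nat.nth_mem_of_infinite hx k)
  have haB : ∀ k, a k ∈ splittingAt x B (e k) := ha
  have hbB : ∀ k, b k ∈ splittingAt x B (e k) := hb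
  set A : Set (ℕ → Bool) := {y | ∃ k, y = a k ∨ z k = true ∧ y = b k}
  have hsplit : ∀ y ∈ A, ∃ k, y ∈ splittingAt x B (e k) ∧ (y = a k ∨ z k = true ∧ y = b k) := by
    rintro y ⟨k, rfl | ⟨hz, rfl⟩⟩
    · exact ⟨k, haB k, Or.inl rfl⟩
    · exact ⟨k, hbB k, Or.inr ⟨hz, rfl⟩⟩
  have haA : ∀ k, a k ∈ splittingAt x A (e k) := fun k => ⟨⟨k, Or.inl rfl⟩, (haB k).2⟩
  have hbA : ∀ k, z k = true → b k ∈ splittingAt x A (e k) :=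
    fun k hz => ⟨⟨k, Or.inr ⟨hz, rfl⟩⟩, (hbB k).2⟩
  have hfib : ∀ k, ∀ y ∈ splittingAt x A (e k), y = a k ∨ z k = true ∧ y = b k := by
    rintro k y ⟨hyA, hxy, hk⟩
    obtain ⟨j, hj, h⟩ := hsplit y hyA
    obtain rfl : j = k := hmono.injective (hj.2.2.symm.trans hk)
    exact h
  have hnonempty : (fun n => (splittingAt x A n).Nonempty) =
      fun n => (splittingAt x B n).Nontrivial := by
    ext n
    constructor
    · rintro ⟨y, hyA, hxy, rfl⟩
      obtain ⟨j, hj, -⟩ := hsplit y hyA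
      rw [hj.2.2]
      exact Nat.nth_mem_of_infinite hx j
    · intro h
      obtain ⟨k, rfl⟩ : n ∈ range e := by rw [he, Nat.range_nth_of_infinite hx]; exact h
      exact ⟨a k, haA k⟩
  refine ⟨A, ?_, ?_, ?_, ?_, ?_⟩
  · intro y hy
    obtain ⟨k, hk, -⟩ := hsplit y hy
    exact hk.1
  · refine ((countable_range a).union (countable_range b)).mono ?_
    rintro y ⟨k, rfl | ⟨-, rfl⟩⟩
    exacts [Or.inl ⟨k, rfl⟩, Or.inr ⟨k, rfl⟩]
  · refine infinite_of_injective_forall_mem (f := a) (fun i j hij => ?_) fun k => (haA k).1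
    refine hmono.injective ?_
    rw [← (haB i).2.2, ← (haB j).2.2, hij]
  · refine tendsto_pi_nhds.2 fun N => ?_
    rw [nhds_discrete, tendsto_pure, eventually_inf_principal, eventually_cofinite]
    refine (((finite_Iic N).image a).union ((finite_Iic N).image b)).subset fun y hy => ?_
    simp only [mem_ofPred_eq, Classical.not_imp, id] at hy
    obtain ⟨k, hk, h⟩ := hsplit y hy.1
    have hkN : k ≤ N := by
      by_contra! hNk
      refine hy.2 (PiNat.apply_eq_of_lt_firstDiff (E := fun _ => Bool) ?_).symm
      rw [hk.2.2]
      exact hNk.trans_le (hmono.id_le k)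
    rcases h with rfl | ⟨-, rfl⟩
    exacts [Or.inl ⟨k, hkN, rfl⟩, Or.inr ⟨k, hkN, rfl⟩]
  · ext k
    have hiff : (splittingAt x A (e k)).Nontrivial ↔ z k = true := by
      constructor
      · rintro ⟨y, hy, y', hy', hne⟩
        by_contra hz
        have h : ∀ w ∈ splittingAt x A (e k), w = a k := fun w hw =>
          (hfib k w hw).resolve_right fun h => hz h.1
        exact hne ((h y hy).trans (h y' hy').symm)
      · exact fun hz => ⟨a k, haA k, b k, hbA k hz, hab k⟩
    rw [Bool.eq_iff_iff, ← hiff, splittingCode, hnonempty]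
    exact @decide_eq_true_iff _ (_)

/-- There is a function `Φ` on the countably infinite subsets of Cantor space such that for
every uncountable `B ⊆ 2^ω`, the image of the countably infinite subsets of `B` under `Φ` is
all of `2^ω`.  In particular, `2^ω` has a classical `ω`-Jónsson function. -/
theorem exists_classical_omega_jonsson_function :
    ∃ Φ : {A : Set (ℕ → Bool) // A.Countable ∧ A.Infinite} → (ℕ → Bool),
      ∀ B : Set (ℕ → Bool), ¬B.Countable → ∀ z : ℕ → Bool,
        ∃ A : {A : Set (ℕ → Bool) // A.Countable ∧ A.Infinite},
          (A : Set (ℕ → Bool)) ⊆ B ∧ Φ A = z := by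
  refine ⟨fun A => splittingCode (limUnder (cofinite ⊓ 𝓟 A.1) id) A.1, fun B hB z => ?_⟩
  obtain ⟨x, -, hx⟩ := exists_condensation_point hB
  obtain ⟨A, hAB, hAc, hAi, hlim, hcode⟩ :=
    exists_splittingCode_eq (infinite_setOf_splittingAt_nontrivial hx) z
  have : (cofinite ⊓ 𝓟 A).NeBot := hAi.cofinite_inf_principal_neBot
  exact ⟨⟨A, hAc, hAi⟩, hAB, by simpa only [hlim.limUnder_eq] using hcode⟩
end

section
/- Suppose (A_n)_{n∈ω} is a sequence of analytic subsets of 2^ω such that for every n ∈ ω there is no E_0-tree map Φ with range(Φ) ⊆ A_n. Then there is no E_0-tree map Φ with range(Φ) ⊆ ⋃_{n∈ω} A_n. -/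
open Set Function

/-- The finite initial segment `s ⌢ v 0 (x 0) ⌢ ⋯ ⌢ v (n-1) (x (n-1))`. -/
def blockPrefix (s : List Bool) (v : ℕ → Bool → List Bool) (x : ℕ → Bool) : ℕ → List Bool
  | 0 => s
  | n + 1 => blockPrefix s v x n ++ v n (x n)

/-- The map `x ↦ s ⌢ v 0 (x 0) ⌢ v 1 (x 1) ⌢ ⋯` determined by a stem `s` and blocks `v`. -/
def e0TreeMapOf (s : List Bool) (v : ℕ → Bool → List Bool) (x : ℕ → Bool) : ℕ → Bool :=
  fun m => (blockPrefix s v x (m + 1)).getD m false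

/-- Conditions on the blocks of an `E₀`-tree: `v n i` starts with `i` and the two blocks at
each level have equal length. -/
def IsE0Blocks (v : ℕ → Bool → List Bool) : Prop :=
  (∀ n i, (v n i).head? = some i) ∧ ∀ n, (v n false).length = (v n true).length

/-- `Φ` is an `E₀`-tree map: `Φ(x) = s ⌢ v_0^{x(0)} ⌢ v_1^{x(1)} ⌢ ⋯`. -/
def IsE0TreeMap (Φ : (ℕ → Bool) → (ℕ → Bool)) : Prop :=
  ∃ s v, IsE0Blocks v ∧ Φ = e0TreeMapOf s v

/-- The set of points near which `S` is everywhere nonmeagre (up to a nowhere dense set). -/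
def nonmeagreCore {X : Type*} [TopologicalSpace X] (S : Set X) : Set X :=
  (closure (⋃₀ {V | IsOpen V ∧ IsMeagre (V ∩ S)}))ᶜ

section Core

variable {X : Type*} [TopologicalSpace X]

lemma isOpen_nonmeagreCore (S : Set X) : IsOpen (nonmeagreCore S) :=
  isClosed_closure.isOpen_compl

lemma disjoint_nonmeagreCore {S V : Set X} (hV : IsOpen V) (h : IsMeagre (V ∩ S)) {x : X}
    (hx : x ∈ V) : x ∉ nonmeagreCore S := fun hxS ↦
  hxS (subset_closure ⟨V, ⟨hV, h⟩, hx⟩)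

lemma isMeagre_frontier_of_isOpen {U : Set X} (hU : IsOpen U) : IsMeagre (frontier U) := by
  have : IsNowhereDense (frontier U) := by
    rw [isClosed_frontier.isNowhereDense_iff]
    rw [← frontier_compl]
    exact interior_frontier hU.isClosed_compl
  exact this.isMeagre

lemma isMeagre_diff_nonmeagreCore [SecondCountableTopology X] (S : Set X) :
    IsMeagre (S \ nonmeagreCore S) := by
  set 𝒱 : Set (Set X) := {V | IsOpen V ∧ IsMeagre (V ∩ S)}
  obtain ⟨T, hTc, hTs, hT⟩ := TopologicalSpace.isOpen_sUnion_countable 𝒱 fun V hV ↦ hV.1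
  have hU : IsOpen (⋃₀ 𝒱) := isOpen_sUnion fun V hV ↦ hV.1
  have h1 : IsMeagre (⋃ V ∈ T, V ∩ S) := isMeagre_biUnion hTc fun V hV ↦ (hTs hV).2
  refine (h1.union (isMeagre_frontier_of_isOpen hU)).mono ?_
  rintro x ⟨hxS, hx⟩
  have hx' : x ∈ closure (⋃₀ 𝒱) := not_not.1 hx
  by_cases hxU : x ∈ ⋃₀ 𝒱
  · left
    rw [← hT] at hxU
    obtain ⟨V, hV, hxV⟩ := hxU
    exact mem_biUnion hV ⟨hxV, hxS⟩
  · right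
    rw [hU.frontier_eq]
    exact ⟨hx', hxU⟩

lemma nonmeagreCore_subset_closure (S : Set X) : nonmeagreCore S ⊆ closure S := by
  intro x hx
  by_contra hxS
  refine disjoint_nonmeagreCore (V := (closure S)ᶜ) isClosed_closure.isOpen_compl ?_ hxS hx
  have : (closure S)ᶜ ∩ S = ∅ := by
    ext y
    simp only [mem_inter_iff, mem_compl_iff, mem_empty_iff_false, iff_false, not_and]
    exact fun h h' ↦ h (subset_closure h')
  rw [this]
  exact IsMeagre.empty

lemma isMeagre_nonmeagreCore_diff_iUnion [SecondCountableTopology X] {ι : Type*} [Countable ι]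
    (S : ι → Set X) :
    IsMeagre (nonmeagreCore (⋃ i, S i) \ ⋃ i, nonmeagreCore (S i)) := by
  have hO : IsOpen (⋃ i, nonmeagreCore (S i)) := isOpen_iUnion fun i ↦ isOpen_nonmeagreCore _
  refine (isMeagre_frontier_of_isOpen hO).mono ?_
  rintro x ⟨hx, hxO⟩
  rw [hO.frontier_eq]
  refine ⟨?_, hxO⟩
  by_contra hxc
  refine disjoint_nonmeagreCore (V := (closure (⋃ i, nonmeagreCore (S i)))ᶜ)
    isClosed_closure.isOpen_compl ?_ hxc hx
  refine (isMeagre_iUnion fun i ↦ isMeagre_diff_nonmeagreCore (S i)).mono ?_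
  rintro y ⟨hy, hyS⟩
  obtain ⟨i, hi⟩ := mem_iUnion.1 hyS
  exact mem_iUnion.2 ⟨i, hi, fun h ↦ hy (subset_closure (mem_iUnion.2 ⟨i, h⟩))⟩

/-- A nonmeagre analytic set is comeagre in some nonempty open set. -/
lemma MeasureTheory.AnalyticSet.exists_isOpen_isMeagre_diff [SecondCountableTopology X] [T2Space X]
    {A : Set X} (hA : MeasureTheory.AnalyticSet A) (hne : ¬ IsMeagre A) :
    ∃ W : Set X, IsOpen W ∧ W.Nonempty ∧ IsMeagre (W \ A) := by
  rw [MeasureTheory.AnalyticSet] at hA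
  rcases hA with rfl | ⟨f, hf, rfl⟩
  · exact absurd IsMeagre.empty hne
  let S : List ℕ → Set X := fun σ ↦ f '' {z | PiNat.res z σ.length = σ}
  have hS0 : S [] = range f := by simp [S]
  have hS : ∀ σ, S σ = ⋃ n, S (n :: σ) := by
    intro σ
    ext x
    simp only [S, mem_image, mem_ofPred_eq, mem_iUnion, List.length_cons, PiNat.res_succ,
      List.cons.injEq]
    constructor
    · rintro ⟨z, hz, rfl⟩
      exact ⟨_, z, ⟨rfl, hz⟩, rfl⟩
    · rintro ⟨n, z, ⟨-, hz⟩, rfl⟩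
      exact ⟨z, hz, rfl⟩
  refine ⟨nonmeagreCore (S []), isOpen_nonmeagreCore _, ?_, ?_⟩
  · rw [hS0]
    by_contra h
    rw [not_nonempty_iff_eq_empty] at h
    have := isMeagre_diff_nonmeagreCore (range f)
    rw [h, sdiff_empty] at this
    exact hne this
  · have hM : IsMeagre (⋃ σ, nonmeagreCore (S σ) \ ⋃ n, nonmeagreCore (S (n :: σ))) := by
      refine isMeagre_iUnion fun σ ↦ ?_
      have := isMeagre_nonmeagreCore_diff_iUnion fun n ↦ S (n :: σ)
      rwa [← hS σ] at this
    refine hM.mono ?_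
    rintro x ⟨hx, hxA⟩
    by_contra hxM
    have hstep : ∀ σ, x ∈ nonmeagreCore (S σ) → ∃ n, x ∈ nonmeagreCore (S (n :: σ)) := by
      intro σ hσ
      by_contra hn
      exact hxM (mem_iUnion.2 ⟨σ, hσ, fun h ↦ hn (mem_iUnion.1 h)⟩)
    choose! g hg using hstep
    let σ : ℕ → List ℕ := fun k ↦ Nat.rec [] (fun _ τ ↦ g τ :: τ) k
    have hσ : ∀ k, PiNat.res (fun k ↦ g (σ k)) k = σ k := by
      intro k
      induction k with
      | zero => rfl
      | succ k ih => rw [PiNat.res_succ, ih]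
    have hxσ : ∀ k, x ∈ nonmeagreCore (S (σ k)) := by
      intro k
      induction k with
      | zero => exact hx
      | succ k ih => exact hg _ ih
    refine hxA ⟨fun k ↦ g (σ k), ?_⟩
    by_contra hfx
    obtain ⟨U, V, hU, hV, hzU, hxV, hUV⟩ := t2_separation hfx
    obtain ⟨_, ⟨y, n, rfl⟩, hzy, hyU⟩ :=
      (PiNat.isTopologicalBasis_cylinders (fun _ : ℕ ↦ ℕ)).exists_subset_of_mem_open
        (show (fun k ↦ g (σ k)) ∈ f ⁻¹' U from hzU) (hU.preimage hf)
    rw [← PiNat.mem_cylinder_iff_eq.1 hzy] at hyU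
    obtain ⟨_, hw, z, hz, rfl⟩ :=
      mem_closure_iff.1 (nonmeagreCore_subset_closure _ (hxσ n)) V hV hxV
    refine hUV.le_bot ⟨hyU ?_, hw⟩
    have hlen : (σ n).length = n := by rw [← hσ n, PiNat.res_length]
    rw [mem_ofPred_eq, hlen, ← hσ n] at hz
    rw [PiNat.cylinder_eq_res]
    exact hz

end Core

section Blocks

/-- The basic clopen set of extensions of a finite binary string. -/
def listCylinder (p : List Bool) : Set (ℕ → Bool) :=
  {x | ∀ i b, p[i]? = some b → x i = b}

lemma listCylinder_append_subset (p q : List Bool) : listCylinder (p ++ q) ⊆ listCylinder p := by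
  intro x hx i b hb
  refine hx i b ?_
  rw [List.getElem?_append_left (List.getElem?_eq_some_iff.1 hb).1, hb]

lemma mem_listCylinder_iff {p : List Bool} {x : ℕ → Bool} :
    x ∈ listCylinder p ↔ (List.range p.length).map x = p := by
  constructor
  · intro h
    refine List.ext_getElem (by simp) fun i h₁ h₂ ↦ ?_
    simpa using h i _ (List.getElem?_eq_getElem h₂)
  · intro h i b hb
    obtain ⟨hi, rfl⟩ := List.getElem?_eq_some_iff.1 hb
    have := List.getElem_of_eq h (i := i) (by simpa using hi)
    simpa using this

lemma listCylinder_map_range (x : ℕ → Bool) (n : ℕ) :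
    listCylinder ((List.range n).map x) = PiNat.cylinder x n := by
  ext y
  rw [mem_listCylinder_iff, PiNat.mem_cylinder_iff]
  simp

lemma isOpen_listCylinder_nonempty (p : List Bool) :
    IsOpen (listCylinder p) ∧ (listCylinder p).Nonempty := by
  have h : (fun i ↦ p.getD i false) ∈ listCylinder p := by
    intro i b hb
    simp [List.getD_eq_getElem?_getD, hb]
  refine ⟨?_, _, h⟩
  rw [← mem_listCylinder_iff.1 h, listCylinder_map_range]
  exact PiNat.isOpen_cylinder _ _ _

lemma exists_listCylinder_subset {U : Set (ℕ → Bool)} (hU : IsOpen U) {x : ℕ → Bool}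
    (hx : x ∈ U) : ∃ n, listCylinder ((List.range n).map x) ⊆ U := by
  obtain ⟨_, ⟨y, n, rfl⟩, hxy, hyU⟩ :=
    (PiNat.isTopologicalBasis_cylinders (fun _ : ℕ ↦ Bool)).exists_subset_of_mem_open hx hU
  refine ⟨n, ?_⟩
  rwa [listCylinder_map_range, PiNat.mem_cylinder_iff_eq.1 hxy]

lemma exists_append_listCylinder_subset {D : Set (ℕ → Bool)} (hD : IsOpen D) (hd : Dense D)
    (p : List Bool) : ∃ w, listCylinder (p ++ w) ⊆ D := by
  obtain ⟨hp, hne⟩ := isOpen_listCylinder_nonempty p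
  obtain ⟨x, hxp, hxD⟩ := hd.inter_open_nonempty _ hp hne
  obtain ⟨n, hn⟩ := exists_listCylinder_subset hD hxD
  refine ⟨((List.range n).map fun i ↦ x (p.length + i)), Subset.trans ?_ hn⟩
  have : p ++ ((List.range n).map fun i ↦ x (p.length + i)) =
      (List.range n).map x ++ ((List.range p.length).map fun i ↦ x (n + i)) := by
    conv_lhs => rw [← mem_listCylinder_iff.1 hxp]
    have h₁ := congrArg (List.map x) (List.range_add (n := p.length) (m := n))
    have h₂ := congrArg (List.map x) (List.range_add (n := n) (m := p.length))
    rw [add_comm p.length n, h₂] at h₁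
    simpa [Function.comp_def] using h₁.symm
  rw [this]
  exact listCylinder_append_subset _ _

/-- One string simultaneously extends finitely many strings into a dense open set. -/
lemma exists_common_append_listCylinder_subset {D : Set (ℕ → Bool)} (hD : IsOpen D)
    (hd : Dense D) (L : List (List Bool)) : ∃ w, ∀ p ∈ L, listCylinder (p ++ w) ⊆ D := by
  induction L with
  | nil => exact ⟨[], by simp⟩
  | cons q L ih =>
    obtain ⟨w, hw⟩ := ih
    obtain ⟨u, hu⟩ := exists_append_listCylinder_subset hD hd (q ++ w)
    refine ⟨w ++ u, ?_⟩
    intro p hp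
    rw [← List.append_assoc]
    rcases List.mem_cons.1 hp with rfl | hp
    · exact hu
    · exact (listCylinder_append_subset _ _).trans (hw p hp)

lemma blockPrefix_append_of_le (s : List Bool) (v : ℕ → Bool → List Bool) (x : ℕ → Bool)
    {m n : ℕ} (h : m ≤ n) : ∃ r, blockPrefix s v x n = blockPrefix s v x m ++ r := by
  induction n, h using Nat.le_induction with
  | base => exact ⟨[], by simp⟩
  | succ n _ ih =>
    obtain ⟨r, hr⟩ := ih
    exact ⟨r ++ v n (x n), by rw [blockPrefix, hr, List.append_assoc]⟩

lemma IsE0Blocks.le_length_blockPrefix {v : ℕ → Bool → List Bool} (hv : IsE0Blocks v)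
    (s : List Bool) (x : ℕ → Bool) (n : ℕ) : n ≤ (blockPrefix s v x n).length := by
  induction n with
  | zero => exact Nat.zero_le _
  | succ n ih =>
    have hpos : 0 < (v n (x n)).length := by
      rw [List.length_pos_iff]
      intro h
      simpa [h] using hv.1 n (x n)
    rw [blockPrefix, List.length_append]
    omega

lemma IsE0Blocks.length_eq {v : ℕ → Bool → List Bool} (hv : IsE0Blocks v) (n : ℕ) (i j : Bool) :
    (v n i).length = (v n j).length := by
  cases i <;> cases j <;> simp [hv.2 n]

lemma IsE0Blocks.length_blockPrefix_eq {v : ℕ → Bool → List Bool} (hv : IsE0Blocks v)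
    (s : List Bool) (x y : ℕ → Bool) (n : ℕ) :
    (blockPrefix s v x n).length = (blockPrefix s v y n).length := by
  induction n with
  | zero => rfl
  | succ n ih =>
    simp only [blockPrefix, List.length_append, ih, hv.length_eq n (x n) (y n)]

lemma IsE0Blocks.e0TreeMapOf_mem_listCylinder {v : ℕ → Bool → List Bool} (hv : IsE0Blocks v)
    (s : List Bool) (x : ℕ → Bool) (n : ℕ) :
    e0TreeMapOf s v x ∈ listCylinder (blockPrefix s v x n) := by
  intro i b hb
  have hi := hv.le_length_blockPrefix s x (i + 1)
  have key : (blockPrefix s v x (i + 1))[i]? = some b := by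
    rcases le_total n (i + 1) with h | h
    · obtain ⟨r, hr⟩ := blockPrefix_append_of_le s v x h
      rw [hr, List.getElem?_append_left (List.getElem?_eq_some_iff.1 hb).1, hb]
    · obtain ⟨r, hr⟩ := blockPrefix_append_of_le s v x h
      rwa [hr, List.getElem?_append_left (by omega)] at hb
  simp [e0TreeMapOf, List.getD_eq_getElem?_getD, key]

lemma IsE0Blocks.eq_e0TreeMapOf {v : ℕ → Bool → List Bool} (hv : IsE0Blocks v)
    {s : List Bool} {x y : ℕ → Bool} (h : ∀ n, y ∈ listCylinder (blockPrefix s v x n)) :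
    y = e0TreeMapOf s v x := by
  funext i
  have hi := hv.le_length_blockPrefix s x (i + 1)
  have hsome := List.getElem?_eq_getElem (l := blockPrefix s v x (i + 1)) (i := i) (by omega)
  rw [h (i + 1) i _ hsome, hv.e0TreeMapOf_mem_listCylinder s x (i + 1) i _ hsome]

/-- The concatenation `v k (p 0) ⌢ v (k+1) (p 1) ⌢ ⋯` along a finite string `p`. -/
def flattenBlocks (v : ℕ → Bool → List Bool) : ℕ → List Bool → List Bool
  | _, [] => []
  | k, b :: p => v k b ++ flattenBlocks v (k + 1) p

lemma flattenBlocks_append (v : ℕ → Bool → List Bool) (k : ℕ) (p q : List Bool) :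
    flattenBlocks v k (p ++ q) = flattenBlocks v k p ++ flattenBlocks v (k + p.length) q := by
  induction p generalizing k with
  | nil => simp [flattenBlocks]
  | cons b p ih =>
    simp only [List.cons_append, flattenBlocks, ih, List.append_assoc, List.length_cons]
    rw [add_right_comm, add_assoc]

lemma IsE0Blocks.length_flattenBlocks {v : ℕ → Bool → List Bool} (hv : IsE0Blocks v) (k : ℕ)
    {p q : List Bool} (h : p.length = q.length) :
    (flattenBlocks v k p).length = (flattenBlocks v k q).length := by
  induction p generalizing k q with
  | nil => rw [List.length_eq_zero_iff.1 h.symm]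
  | cons b p ih =>
    cases q with
    | nil => simp at h
    | cons c q =>
      simp only [flattenBlocks, List.length_append, hv.length_eq k b c,
        ih (k + 1) (Nat.succ.inj h)]

lemma blockPrefix_eq_append_flattenBlocks (s : List Bool) (v : ℕ → Bool → List Bool)
    (x : ℕ → Bool) (n : ℕ) :
    blockPrefix s v x n = s ++ flattenBlocks v 0 ((List.range n).map x) := by
  induction n with
  | zero => simp [blockPrefix, flattenBlocks]
  | succ n ih =>
    rw [blockPrefix, ih, List.range_succ, List.map_append, flattenBlocks_append]
    simp [flattenBlocks]

lemma IsE0TreeMap.comp {Φ Ψ : (ℕ → Bool) → (ℕ → Bool)} (hΦ : IsE0TreeMap Φ)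
    (hΨ : IsE0TreeMap Ψ) : IsE0TreeMap (Φ ∘ Ψ) := by
  obtain ⟨s, v, hv, rfl⟩ := hΦ
  obtain ⟨t, u, hu, rfl⟩ := hΨ
  let w : ℕ → Bool → List Bool := fun n i ↦
    flattenBlocks v (blockPrefix t u (fun _ ↦ false) n).length (u n i)
  have hw : IsE0Blocks w := by
    refine ⟨fun n i ↦ ?_, fun n ↦ hv.length_flattenBlocks _ (hu.2 n)⟩
    obtain ⟨q, hq⟩ := List.head?_eq_some_iff.1 (hu.1 n i)
    simp only [w, hq, flattenBlocks, List.head?_append, hv.1, Option.some_or]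
  have hpre : ∀ x n, blockPrefix (s ++ flattenBlocks v 0 t) w x n =
      s ++ flattenBlocks v 0 (blockPrefix t u x n) := by
    intro x n
    induction n with
    | zero => rfl
    | succ n ih =>
      rw [blockPrefix, ih, blockPrefix, flattenBlocks_append, List.append_assoc, zero_add,
        hu.length_blockPrefix_eq t x fun _ ↦ false]
  refine ⟨s ++ flattenBlocks v 0 t, w, hw, funext fun x ↦ hw.eq_e0TreeMapOf fun n ↦ ?_⟩
  have h := mem_listCylinder_iff.1 (hu.e0TreeMapOf_mem_listCylinder t x n)
  rw [hpre, ← h, ← blockPrefix_eq_append_flattenBlocks]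
  exact hv.e0TreeMapOf_mem_listCylinder _ _ _

lemma isLocallyConstant_blockPrefix (s : List Bool) (v : ℕ → Bool → List Bool) (n : ℕ) :
    IsLocallyConstant fun x ↦ blockPrefix s v x n := by
  induction n with
  | zero => exact IsLocallyConstant.const s
  | succ n ih =>
    have h : IsLocallyConstant fun x : ℕ → Bool ↦ x n :=
      (IsLocallyConstant.iff_continuous _).2 (continuous_apply n)
    exact ih.comp₂ h fun p b ↦ p ++ v n b

lemma IsE0TreeMap.continuous {Φ : (ℕ → Bool) → (ℕ → Bool)} (hΦ : IsE0TreeMap Φ) :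
    Continuous Φ := by
  obtain ⟨s, v, -, rfl⟩ := hΦ
  exact continuous_pi fun m ↦
    ((isLocallyConstant_blockPrefix s v (m + 1)).comp fun p ↦ p.getD m false).continuous

/-- A set that is comeagre in a nonempty open set contains the body of an `E₀`-tree. -/
lemma exists_isE0TreeMap_of_isMeagre_diff {W A : Set (ℕ → Bool)} (hW : IsOpen W)
    (hne : W.Nonempty) (h : IsMeagre (W \ A)) : ∃ Φ, IsE0TreeMap Φ ∧ range Φ ⊆ A := by
  obtain ⟨G, hGs, hGδ, hGd⟩ := mem_residual.1 h
  obtain ⟨D, hDo, rfl⟩ := isGδ_iff_eq_iInter_nat.1 hGδ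
  have hD : ∀ n, Dense (D n) := fun n ↦ hGd.mono (iInter_subset D n)
  obtain ⟨x, hx⟩ := hne
  obtain ⟨k, hk⟩ := exists_listCylinder_subset hW hx
  set s := (List.range k).map x
  have hpick : ∀ n (L : List (List Bool)), ∃ w, ∀ p ∈ L, ∀ i : Bool,
      listCylinder (p ++ i :: w) ⊆ D n := by
    intro n L
    obtain ⟨w, hw⟩ := exists_common_append_listCylinder_subset (hDo n) (hD n)
      (L.flatMap fun p ↦ [p ++ [false], p ++ [true]])
    refine ⟨w, fun p hp i ↦ ?_⟩
    have := hw (p ++ [i]) (List.mem_flatMap.2 ⟨p, hp, by cases i <;> simp⟩)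
    simpa using this
  choose pick h_pick using hpick
  let P : ℕ → List (List Bool) := fun n ↦ Nat.rec [s] (fun n L ↦
    L.flatMap fun p ↦ [p ++ false :: pick n L, p ++ true :: pick n L]) n
  let v : ℕ → Bool → List Bool := fun n i ↦ i :: pick n (P n)
  have hv : IsE0Blocks v := ⟨fun n i ↦ rfl, fun n ↦ rfl⟩
  have hP : ∀ y n, blockPrefix s v y n ∈ P n := by
    intro y n
    induction n with
    | zero => exact List.mem_singleton.2 rfl
    | succ n ih =>
      refine List.mem_flatMap.2 ⟨_, ih, ?_⟩
      rw [blockPrefix]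
      cases y n <;> simp [v, P]
  refine ⟨e0TreeMapOf s v, ⟨s, v, hv, rfl⟩, ?_⟩
  rintro _ ⟨y, rfl⟩
  have hyD : e0TreeMapOf s v y ∈ ⋂ n, D n := mem_iInter.2 fun n ↦
    h_pick n (P n) _ (hP y n) (y n) (hv.e0TreeMapOf_mem_listCylinder s y (n + 1))
  have hyW : e0TreeMapOf s v y ∈ W := hk (hv.e0TreeMapOf_mem_listCylinder s y 0)
  by_contra hyA
  exact hGs hyD ⟨hyW, hyA⟩

end Blocks

/-- If no `E₀`-tree map has range inside any of the analytic sets `A n`, then no `E₀`-tree map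
has range inside their union. -/
theorem no_e0_tree_in_countable_union (A : ℕ → Set (ℕ → Bool))
    (hA : ∀ n, MeasureTheory.AnalyticSet (A n))
    (h : ∀ n, ¬∃ Φ, IsE0TreeMap Φ ∧ range Φ ⊆ A n) :
    ¬∃ Φ, IsE0TreeMap Φ ∧ range Φ ⊆ ⋃ n, A n := by
  rintro ⟨Φ, hΦ, hsub⟩
  have hne : ∃ n, ¬ IsMeagre (Φ ⁻¹' A n) := by
    by_contra! hm
    refine not_isMeagre_of_isOpen (X := ℕ → Bool) isOpen_univ univ_nonempty
      ((isMeagre_iUnion hm).mono fun x _ ↦ ?_)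
    obtain ⟨n, hn⟩ := mem_iUnion.1 (hsub (mem_range_self x))
    exact mem_iUnion.2 ⟨n, hn⟩
  obtain ⟨n, hn⟩ := hne
  have : PolishSpace Bool := {}
  obtain ⟨W, hWo, hWne, hW⟩ :=
    ((hA n).preimage hΦ.continuous).exists_isOpen_isMeagre_diff hn
  obtain ⟨Ψ, hΨ, hΨA⟩ := exists_isE0TreeMap_of_isMeagre_diff hWo hWne hW
  refine h n ⟨Φ ∘ Ψ, hΦ.comp hΨ, ?_⟩
  rintro _ ⟨x, rfl⟩
  exact hΨA (mem_range_self x)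
end

section
/- For k ∈ ω let D_k = {(x,y,z) ∈ (2^ω)³ : ∃n ≥ k (x(n) ≠ y(n) ∧ x(n) ≠ z(n) ∧ y(n+1) ≠ z(n+1))}, and let C = ⋂_{k∈ω} D_k. Then each D_k is dense open in (2^ω)³ (so C is comeager), and for all Borel sets A_0, A_1, A_2 ⊆ 2^ω such that each A_i admits a Borel reduction of E_0 into E_0 ↾ A_i and [A_0]_{E_0} = [A_1]_{E_0} = [A_2]_{E_0}, the set A_0 ×_{E_0} A_1 ×_{E_0} A_2 is not contained in C. Hence E_0 does not have the weak 3-Mycielski property. -/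
open Set Function

/-- The eventual-agreement equivalence relation `E₀`: `x E₀ y` iff `∃ n ∀ k > n, x k = y k`. -/
def E0 {α : Type*} (x y : ℕ → α) : Prop := ∃ n, ∀ k > n, x k = y k

/-- The `E₀`-saturation of a set. -/
def satE0 (A : Set (ℕ → Bool)) : Set (ℕ → Bool) := {y | ∃ x ∈ A, E0 x y}

/-- `A₀ ×_{E₀} A₁ ×_{E₀} A₂`: triples with `xᵢ ∈ Aᵢ`, pairwise `E₀`-inequivalent. -/
def prodE0 (A0 A1 A2 : Set (ℕ → Bool)) : Set ((ℕ → Bool) × (ℕ → Bool) × (ℕ → Bool)) :=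
  {p | p.1 ∈ A0 ∧ p.2.1 ∈ A1 ∧ p.2.2 ∈ A2 ∧
    ¬E0 p.1 p.2.1 ∧ ¬E0 p.1 p.2.2 ∧ ¬E0 p.2.1 p.2.2}

/-- The dense open sets whose intersection witnesses the failure of the weak 3-Mycielski
property for `E₀`. -/
def D6 (k : ℕ) : Set ((ℕ → Bool) × (ℕ → Bool) × (ℕ → Bool)) :=
  {p | ∃ n ≥ k, p.1 n ≠ p.2.1 n ∧ p.1 n ≠ p.2.2 n ∧ p.2.1 (n + 1) ≠ p.2.2 (n + 1)}

/-- `splice x k z` agrees with `x` below `k` and with `z` from `k` on. -/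
def splice {α : Type*} (x : ℕ → α) (k : ℕ) (z : ℕ → α) : ℕ → α :=
  fun i => if i < k then x i else z i

/-- Flip the bits of `x` at the positions in `s`. -/
def flipBits (s : Finset ℕ) (x : ℕ → Bool) : ℕ → Bool := fun k => xor (decide (k ∈ s)) (x k)

section E0

variable {α : Type*} {x y z : ℕ → α}

theorem E0.symm (h : E0 x y) : E0 y x :=
  h.imp fun _ hn k hk => (hn k hk).symm

theorem E0.trans (h : E0 x y) (h' : E0 y z) : E0 x z := by
  obtain ⟨m, hm⟩ := h
  obtain ⟨n, hn⟩ := h'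
  exact ⟨max m n, fun k hk => (hm k (by omega)).trans (hn k (by omega))⟩

theorem splice_of_lt {k i : ℕ} (h : i < k) : splice x k z i = x i := if_pos h

theorem splice_of_le {k i : ℕ} (h : k ≤ i) : splice x k z i = z i := if_neg (by omega)

theorem e0_splice (x : ℕ → α) (k : ℕ) (z : ℕ → α) : E0 (splice x k z) z :=
  ⟨k, fun _ hi => splice_of_le hi.le⟩

theorem splice_eq_self {k : ℕ} (h : ∀ i < k, x i = z i) : splice x k z = z := by
  funext i
  by_cases hi : i < k
  · rw [splice_of_lt hi, h i hi]
  · exact splice_of_le (by omega)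

theorem tendsto_splice [TopologicalSpace α] (x : ℕ → α) (z : ℕ → ℕ → α) :
    Filter.Tendsto (fun k => splice x k (z k)) Filter.atTop (nhds x) := by
  refine tendsto_pi_nhds.2 fun i => tendsto_const_nhds.congr' ?_
  filter_upwards [Filter.eventually_gt_atTop i] with k hk
  exact (splice_of_lt hk).symm

theorem eventually_splice_mem [TopologicalSpace α] {V : Set (ℕ → α)} (hV : IsOpen V) (hx : x ∈ V) :
    ∀ᶠ k in Filter.atTop, ∀ z, splice x k z ∈ V := by
  obtain ⟨I, u, hu, hI⟩ := isOpen_pi_iff.1 hV x hx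
  filter_upwards [Filter.eventually_gt_atTop (I.sup id)] with k hk z
  refine hI fun i hi => ?_
  have hik : i < k := (Finset.le_sup (f := id) (Finset.mem_coe.1 hi)).trans_lt hk
  rw [splice_of_lt hik]
  exact (hu i hi).2

end E0

theorem flipBits_flipBits (s : Finset ℕ) (x : ℕ → Bool) : flipBits s (flipBits s x) = x := by
  funext k
  simp [flipBits]

theorem continuous_flipBits (s : Finset ℕ) : Continuous (flipBits s) :=
  continuous_pi fun k => (continuous_of_discreteTopology (f := xor (decide (k ∈ s)))).comp
    (continuous_apply k)

theorem exists_forall_flipBits_eq (s : Finset ℕ) :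
    ∃ N, ∀ n ≥ N, ∀ x, flipBits s x n = x n := by
  refine ⟨s.sup id + 1, fun n hn x => ?_⟩
  have h : n ∉ s := fun hs => by
    have : n ≤ s.sup id := Finset.le_sup (f := id) hs
    omega
  simp [flipBits, h]

theorem e0_flipBits (s : Finset ℕ) (x : ℕ → Bool) : E0 (flipBits s x) x :=
  let ⟨N, hN⟩ := exists_forall_flipBits_eq s
  ⟨N, fun k hk => hN k (le_of_lt hk) x⟩

theorem E0.exists_flipBits_eq {x y : ℕ → Bool} (h : E0 x y) : ∃ s, flipBits s x = y := by
  obtain ⟨n, hn⟩ := h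
  refine ⟨(Finset.range (n + 1)).filter fun k => x k ≠ y k, funext fun k => ?_⟩
  by_cases hk : k > n
  · have := hn k hk
    simp [flipBits, this]
  · have : k < n + 1 := by omega
    cases hx : x k <;> cases hy : y k <;> simp [flipBits, hx, hy, this]

theorem splice_flipBits {s : Finset ℕ} {k : ℕ} {z : ℕ → Bool} (x : ℕ → Bool)
    (h : ∀ n ≥ k, ∀ x, flipBits s x n = x n) :
    splice (flipBits s x) k z = flipBits s (splice x k z) := by
  funext i
  by_cases hi : i < k
  · simp [splice_of_lt hi, flipBits]
  · rw [splice_of_le (by omega), h i (by omega), splice_of_le (by omega)]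

/-- Taking preimages under an involutive homeomorphism preserves residual sets. -/
theorem preimage_mem_residual_of_involutive {X : Type*} [TopologicalSpace X] {g : X → X}
    (hg : Involutive g) (hc : Continuous g) {R : Set X} (hR : R ∈ residual X) :
    g ⁻¹' R ∈ residual X :=
  tendsto_residual_of_isOpenMap hc (Homeomorph.mk hg.toPerm hc hc).isOpenMap hR

/-- Countably many Borel sets become relatively open on some `E₀`-invariant dense `G_δ` set. -/
theorem exists_invariant_residual_relatively_open {ι : Type*} [Countable ι]
    (C : ι → Set (ℕ → Bool)) (hC : ∀ i, MeasurableSet (C i)) :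
    ∃ U : ℕ → Set (ℕ → Bool), (∀ r, IsOpen (U r)) ∧ (⋂ r, U r) ∈ residual (ℕ → Bool) ∧
      (∀ x y, E0 x y → x ∈ ⋂ r, U r → y ∈ ⋂ r, U r) ∧
      ∀ i, ∀ x ∈ ⋂ r, U r, x ∈ C i →
        ∀ᶠ k in Filter.atTop, ∀ z ∈ ⋂ r, U r, splice x k z ∈ C i := by
  choose V hVo hV using fun i => (hC i).residualEq_isOpen
  have hR : {x | ∀ i, x ∈ C i ↔ x ∈ V i} ∈ residual (ℕ → Bool) :=
    eventually_countable_forall.2 fun i => Filter.eventuallyEq_set.1 (hV i)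
  obtain ⟨T, hTR, hTG, hTd⟩ := mem_residual.1 hR
  have hinv : ∀ s, Involutive (flipBits s) := flipBits_flipBits
  have hG : IsGδ (⋂ s, flipBits s ⁻¹' T) :=
    IsGδ.iInter fun s => hTG.preimage (continuous_flipBits s)
  obtain ⟨U, hU, hGU⟩ := hG.eq_iInter_nat
  have hE : ∀ x y, E0 x y → x ∈ ⋂ r, U r → y ∈ ⋂ r, U r := by
    rw [← hGU]
    intro x y hxy hx
    refine mem_iInter.2 fun s => ?_
    obtain ⟨t, ht⟩ := (hxy.trans (e0_flipBits s y).symm).exists_flipBits_eq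
    exact mem_preimage.2 (ht ▸ mem_iInter.1 hx t)
  have hsub : ⋂ r, U r ⊆ T := by
    rw [← hGU]
    intro x hx
    have h := mem_iInter.1 hx ∅
    have h' : flipBits ∅ x = x := by funext k; simp [flipBits]
    rwa [mem_preimage, h'] at h
  refine ⟨U, hU, ?_, hE, fun i x hx hxC => ?_⟩
  · rw [← hGU]
    exact countable_iInter_mem.2 fun s =>
      preimage_mem_residual_of_involutive (hinv s) (continuous_flipBits s)
        (residual_of_dense_Gδ hTG hTd)
  · filter_upwards [eventually_splice_mem (hVo i) ((hTR (hsub hx) i).1 hxC)] with k hk z hz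
    exact (hTR (hsub (hE _ _ (e0_splice x k z).symm hz)) i).2 (hk z)

section Fusion

variable {ι : Type*} {G : Set (ℕ → Bool)} {f : (ℕ → Bool) → ℕ → Bool}

/-- A fusion condition for `f` on `G`: a finite family of points of `G`, of which only the
restrictions below `m` matter. From `N` on, the values of `f` do not depend on the index once a
common tail is chosen; up to `N`, they do not depend on the tail. -/
structure FusionCondition (G : Set (ℕ → Bool)) (f : (ℕ → Bool) → ℕ → Bool) (ι : Type*) where
  /-- The points approximating the limit of the fusion. -/
  p : ι → ℕ → Bool
  /-- The length of the prefixes that are fixed. -/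
  m : ℕ
  /-- The position up to which the values of `f` are decided. -/
  N : ℕ
  mem : ∀ j, p j ∈ G
  agree : ∀ z ∈ G, ∀ n ≥ N, ∀ i j, f (splice (p i) m z) n = f (splice (p j) m z) n
  decided : ∀ z ∈ G, ∀ n ≤ N, ∀ j, f (splice (p j) m z) n = f (p j) n

theorem FusionCondition.exists_extension [Finite ι] [Nonempty ι]
    (hinv : ∀ x y, E0 x y → x ∈ G → y ∈ G)
    (hcont : ∀ x ∈ G, ∀ n, ∀ᶠ k in Filter.atTop, ∀ z ∈ G, f (splice x k z) n = f x n)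
    (hagree : ∀ x ∈ G, ∀ y, E0 x y →
      ∃ N, ∀ᶠ k in Filter.atTop, ∀ z ∈ G, ∀ n ≥ N, f (splice x k z) n = f (splice y k z) n)
    (hE : ∀ x y, E0 (f x) (f y) → E0 x y)
    (hne : ∃ x ∈ G, ∃ y ∈ G, ¬E0 x y)
    (S : FusionCondition G f ι) (a : ι → Bool) {U : Set (ℕ → Bool)} (hU : IsOpen U)
    (hGU : G ⊆ U) :
    ∃ S' : FusionCondition G f ι, S.m < S'.m ∧ S.N < S'.N ∧
      (∀ j, ∀ k < S.m, S'.p j k = S.p j k) ∧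
      (∀ j z, splice (S'.p j) S'.m z ∈ U) ∧
      (∀ i j, a i = a j → ∀ n ≥ S.N, f (S'.p i) n = f (S'.p j) n) ∧
      (∀ i j, a i ≠ a j → ∃ n, S.N ≤ n ∧ n < S'.N ∧ f (S'.p i) n ≠ f (S'.p j) n) := by
  obtain ⟨x, hx, y, hy, hxy⟩ := hne
  let w : Bool → ℕ → Bool := fun b => if b then x else y
  have hw : ∀ b, w b ∈ G := by
    intro b
    cases b
    exacts [hy, hx]
  have hS : ∀ j, ∀ z ∈ G, splice (S.p j) S.m z ∈ G := fun j z hz =>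
    hinv _ _ (e0_splice _ _ _).symm hz
  obtain ⟨j₀⟩ := ‹Nonempty ι›
  obtain ⟨n₁, hn₁, hdiff⟩ : ∃ n ≥ S.N,
      f (splice (S.p j₀) S.m x) n ≠ f (splice (S.p j₀) S.m y) n := by
    by_contra! h
    refine hxy ((e0_splice (S.p j₀) S.m x).symm.trans ((hE _ _ ?_).trans (e0_splice (S.p j₀) S.m y)))
    exact ⟨S.N, fun k hk => h k hk.le⟩
  obtain ⟨k, hk, hkm⟩ := ((Filter.eventually_all.2 fun j =>
    hcont _ (hS j _ (hw (a j))) n₁).and (Filter.eventually_ge_atTop S.m)).exists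
  let p : ι → ℕ → Bool := fun j => splice (splice (S.p j) S.m (w (a j))) k x
  have hp_e0 : ∀ j, E0 (p j) x := fun j => e0_splice _ _ _
  have hpG : ∀ j, p j ∈ G := fun j => hinv _ _ (hp_e0 j).symm hx
  let v : Bool → ℕ → Bool := fun b => splice (w b) k x
  have hv : ∀ b, v b ∈ G := fun b => hinv _ _ (e0_splice _ _ _).symm hx
  have hpv : ∀ j, p j = splice (S.p j) S.m (v (a j)) := by
    intro j
    funext i
    simp only [p, v, splice]
    split_ifs <;> first | rfl | omega
  have hp_n₁ : ∀ j, f (p j) n₁ = f (splice (S.p j₀) S.m (w (a j))) n₁ := fun j =>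
    (hk j x hx).trans (S.agree _ (hw _) n₁ hn₁ j j₀)
  choose M hM using fun j => hagree _ (hpG j₀) (p j) ((hp_e0 j₀).trans (hp_e0 j).symm)
  obtain ⟨M', hM'⟩ := (Set.finite_range M).bddAbove
  let N := max (n₁ + 1) M'
  obtain ⟨m, ⟨⟨hm₁, hm₂⟩, hm₃⟩, hm₄⟩ := (((Filter.eventually_all.2 hM).and
    (Filter.eventually_all.2 fun j => (Finset.eventually_all (Finset.range (N + 1))).2
      fun n _ => hcont _ (hpG j) n)).and
    (Filter.eventually_all.2 fun j => eventually_splice_mem hU (hGU (hpG j)))).and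
    (Filter.eventually_gt_atTop S.m) |>.exists
  have hmN : ∀ z ∈ G, ∀ n ≥ N, ∀ j, f (splice (p j₀) m z) n = f (splice (p j) m z) n :=
    fun z hz n hn j => hm₁ j z hz n
      (((hM' (Set.mem_range_self j)).trans (le_max_right _ _)).trans hn)
  refine ⟨⟨p, m, N, hpG, fun z hz n hn i j => (hmN z hz n hn i).symm.trans (hmN z hz n hn j),
    fun z hz n hn j => hm₂ j n (Finset.mem_range.2 (by omega)) z hz⟩, hm₄, ?_, ?_, hm₃, ?_, ?_⟩
  · exact (hn₁.trans_lt (Nat.lt_succ_self _)).trans_le (le_max_left _ _)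
  · intro j i hi
    exact (congrFun (hpv j) i).trans (splice_of_lt hi)
  · intro i j hij n hn
    change f (p i) n = f (p j) n
    rw [hpv i, hpv j, hij]
    exact S.agree _ (hv _) n hn i j
  · intro i j hij
    refine ⟨n₁, hn₁, lt_of_lt_of_le (Nat.lt_succ_self _) (le_max_left _ _), ?_⟩
    change f (p i) n₁ ≠ f (p j) n₁
    rw [hp_n₁, hp_n₁]
    cases hi : a i <;> cases hj : a j
    · exact absurd (hi.trans hj.symm) hij
    · exact hdiff.symm
    · exact hdiff
    · exact absurd (hi.trans hj.symm) hij

/-- The fusion of a sequence of conditions following a prescribed sequence of partitions `a r`. -/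
theorem exists_fusion [Finite ι] [Nonempty ι] {U : ℕ → Set (ℕ → Bool)}
    (hU : ∀ r, IsOpen (U r)) (hGU : G = ⋂ r, U r)
    (hinv : ∀ x y, E0 x y → x ∈ G → y ∈ G)
    (hcont : ∀ x ∈ G, ∀ n, ∀ᶠ k in Filter.atTop, ∀ z ∈ G, f (splice x k z) n = f x n)
    (hagree : ∀ x ∈ G, ∀ y, E0 x y →
      ∃ N, ∀ᶠ k in Filter.atTop, ∀ z ∈ G, ∀ n ≥ N, f (splice x k z) n = f (splice y k z) n)
    (hE : ∀ x y, E0 (f x) (f y) → E0 x y)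
    (hne : ∃ x ∈ G, ∃ y ∈ G, ¬E0 x y)
    (a : ℕ → ι → Bool) {x₀ : ℕ → Bool} (hx₀ : x₀ ∈ G) {B : Set (ℕ → Bool)}
    (hB : ∀ᶠ k in Filter.atTop, ∀ z ∈ G, splice x₀ k z ∈ B) :
    ∃ (y : ι → ℕ → Bool) (N : ℕ → ℕ), StrictMono N ∧ N 0 = 0 ∧ (∀ j, y j ∈ B) ∧
      (∀ r i j, a r i = a r j → ∀ n, N r ≤ n → n ≤ N (r + 1) → f (y i) n = f (y j) n) ∧
      (∀ r i j, a r i ≠ a r j → ∃ n, N r ≤ n ∧ f (y i) n ≠ f (y j) n) := by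
  obtain ⟨m₀, hm₀, hm₀B⟩ := ((hcont x₀ hx₀ 0).and hB).exists
  let S₀ : FusionCondition G f ι := ⟨fun _ => x₀, m₀, 0, fun _ => hx₀, fun _ _ _ _ _ _ => rfl,
    fun z hz n hn _ => by rw [Nat.le_zero.1 hn]; exact hm₀ z hz⟩
  choose next hm hN hp hnU heq hneq using fun (r : ℕ) (S : FusionCondition G f ι) =>
    S.exists_extension hinv hcont hagree hE hne (a r) (hU r) (hGU.trans_subset (iInter_subset U r))
  let S : ℕ → FusionCondition G f ι := fun r => Nat.rec S₀ next r
  have hmono : StrictMono fun r => (S r).m := strictMono_nat_of_lt_succ fun r => hm r (S r)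
  have hstable : ∀ j r r', r ≤ r' → ∀ k < (S r).m, (S r').p j k = (S r).p j k := by
    intro j r r' h
    induction r', h using Nat.le_induction with
    | base => exact fun _ _ => rfl
    | succ r' h ih =>
      exact fun k hk => (hp r' (S r') j k (hk.trans_le (hmono.monotone h))).trans (ih k hk)
  let y : ι → ℕ → Bool := fun j k => (S (k + 1)).p j k
  have hy : ∀ j r, splice ((S r).p j) (S r).m (y j) = y j := by
    intro j r
    refine splice_eq_self fun k hk => ?_
    rcases le_total r (k + 1) with h | h
    · exact (hstable j r (k + 1) h k hk).symm
    · exact hstable j (k + 1) r h k (Nat.lt_of_succ_le (hmono.le_apply))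
  have hyG : ∀ j, y j ∈ G := by
    intro j
    rw [hGU]
    refine mem_iInter.2 fun r => ?_
    rw [← hy j (r + 1)]
    exact hnU r (S r) j (y j)
  have hfy : ∀ j r, ∀ n ≤ (S r).N, f (y j) n = f ((S r).p j) n := by
    intro j r n hn
    rw [← (S r).decided _ (hyG j) n hn j, hy]
  refine ⟨y, fun r => (S r).N, strictMono_nat_of_lt_succ fun r => hN r (S r), rfl, ?_, ?_, ?_⟩
  · intro j
    rw [← hy j 0]
    exact hm₀B _ (hyG j)
  · intro r i j hij n hn hn'
    rw [hfy i (r + 1) n hn', hfy j (r + 1) n hn']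
    exact heq r (S r) i j hij n hn
  · intro r i j hij
    obtain ⟨n, hn, hn', h⟩ := hneq r (S r) i j hij
    refine ⟨n, hn, ?_⟩
    rwa [hfy i (r + 1) n hn'.le, hfy j (r + 1) n hn'.le]

end Fusion

theorem isOpen_D6 (k : ℕ) : IsOpen (D6 k) := by
  have h : ∀ n, Continuous fun p : (ℕ → Bool) × (ℕ → Bool) × (ℕ → Bool) =>
      (p.1 n, p.2.1 n, p.2.2 n, p.2.1 (n + 1), p.2.2 (n + 1)) := fun n => by fun_prop
  have hD : D6 k = ⋃ n ≥ k, (fun p : (ℕ → Bool) × (ℕ → Bool) × (ℕ → Bool) =>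
      (p.1 n, p.2.1 n, p.2.2 n, p.2.1 (n + 1), p.2.2 (n + 1))) ⁻¹'
        {q | q.1 ≠ q.2.1 ∧ q.1 ≠ q.2.2.1 ∧ q.2.2.2.1 ≠ q.2.2.2.2} := by
    ext p
    simp only [D6, mem_ofPred_eq, mem_iUnion, mem_preimage, exists_prop]
  rw [hD]
  exact isOpen_biUnion fun n _ => (isOpen_discrete _).preimage (h n)

theorem dense_D6 (k : ℕ) : Dense (D6 k) := by
  rintro ⟨x, y, z⟩
  refine mem_closure_of_tendsto ((tendsto_splice x fun _ _ => true).prodMk_nhds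
    ((tendsto_splice y fun _ _ => false).prodMk_nhds
      (tendsto_splice z fun n i => decide (i = n + 1)))) ?_
  filter_upwards [Filter.eventually_ge_atTop k] with n hn
  exact ⟨n, hn, by simp [splice], by simp [splice], by simp [splice]⟩

theorem not_e0_of_forall_exists_ne {x y : ℕ → Bool} {N : ℕ → ℕ} (hN : StrictMono N)
    (h : ∀ r, ∃ r' ≥ r, ∃ n, N r' ≤ n ∧ x n ≠ y n) : ¬E0 x y := by
  rintro ⟨n, hn⟩
  obtain ⟨r, hr, k, hk, hne⟩ := h (n + 1)
  have : r ≤ N r := hN.le_apply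
  exact hne (hn k (by omega))

/-- A Borel reduction of `E₀` to itself takes, on some piece of a countable Borel cover, three
pairwise inequivalent values whose triple lies outside `D6 0`. -/
theorem exists_triple_notMem_D6 {κ : Type*} [Countable κ] {f : (ℕ → Bool) → ℕ → Bool}
    (hf : Measurable f) (hE : ∀ x y, E0 x y ↔ E0 (f x) (f y)) (B : κ → Set (ℕ → Bool))
    (hBm : ∀ c, MeasurableSet (B c)) (hB : ∀ x, ∃ c, x ∈ B c) :
    ∃ c, ∃ x ∈ B c, ∃ y ∈ B c, ∃ z ∈ B c, ¬E0 (f x) (f y) ∧ ¬E0 (f x) (f z) ∧ ¬E0 (f y) (f z) ∧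
      (f x, f y, f z) ∉ D6 0 := by
  have hfn : ∀ n, Measurable fun x => f x n := fun n => (measurable_pi_apply n).comp hf
  have hfs : ∀ s n, Measurable fun x => f (flipBits s x) n := fun s n =>
    (hfn n).comp (continuous_flipBits s).measurable
  let C : (ℕ × Bool) ⊕ (Finset ℕ × ℕ) ⊕ κ → Set (ℕ → Bool) := Sum.elim
    (fun q => {x | f x q.1 = q.2}) (Sum.elim
      (fun q => {x | ∀ n ≥ q.2, f x n = f (flipBits q.1 x) n}) B)
  have hC : ∀ i, MeasurableSet (C i) := by
    rintro (⟨n, b⟩ | ⟨s, N⟩ | c)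
    · exact hfn n (measurableSet_singleton b)
    · have : C (Sum.inr (Sum.inl (s, N))) = ⋂ n, ⋂ (_ : n ≥ N), {x | f x n = f (flipBits s x) n} := by
        ext
        simp [C]
      rw [this]
      exact MeasurableSet.iInter fun n => MeasurableSet.iInter fun _ =>
        measurableSet_eq_fun (hfn n) (hfs s n)
    · exact hBm c
  obtain ⟨U, hU, hres, hinv, hloc⟩ := exists_invariant_residual_relatively_open C hC
  have hne : ∃ x ∈ ⋂ r, U r, ∃ y ∈ ⋂ r, U r, ¬E0 x y := by
    have hc : Continuous fun (x : ℕ → Bool) k => !x k := continuous_pi fun k =>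
      (continuous_of_discreteTopology (f := not)).comp (continuous_apply k)
    have hi : Involutive fun (x : ℕ → Bool) k => !x k := fun x => by simp
    obtain ⟨x, hx, hx'⟩ := (dense_of_mem_residual
      (Filter.inter_mem hres (preimage_mem_residual_of_involutive hi hc hres))).nonempty
    refine ⟨x, hx, _, hx', fun ⟨n, hn⟩ => ?_⟩
    have := hn (n + 1) (Nat.lt_succ_self n)
    simp at this
  obtain ⟨x₀, hx₀, -⟩ := id hne
  obtain ⟨c, hc⟩ := hB x₀
  have hcont : ∀ x ∈ ⋂ r, U r, ∀ n, ∀ᶠ k in Filter.atTop, ∀ z ∈ ⋂ r, U r,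
      f (splice x k z) n = f x n := fun x hx n => hloc (Sum.inl (n, f x n)) x hx rfl
  have hagree : ∀ x ∈ ⋂ r, U r, ∀ y, E0 x y → ∃ N, ∀ᶠ k in Filter.atTop, ∀ z ∈ ⋂ r, U r,
      ∀ n ≥ N, f (splice x k z) n = f (splice y k z) n := by
    intro x hx y hxy
    obtain ⟨N, hN⟩ := (hE x y).1 hxy
    obtain ⟨s, rfl⟩ := hxy.exists_flipBits_eq
    obtain ⟨M, hM⟩ := exists_forall_flipBits_eq s
    refine ⟨N + 1, ?_⟩
    filter_upwards [hloc (Sum.inr (Sum.inl (s, N + 1))) x hx fun n hn => hN n hn,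
      Filter.eventually_ge_atTop M] with k hk hkM z hz
    rw [splice_flipBits x fun n hn => hM n (le_trans hkM hn)]
    exact hk z hz
  let a : ℕ → Fin 3 → Bool := fun r j => if Even r then decide (j = 0) else decide (j = 2)
  have ha_even : ∀ r, Even r → a r = fun j => decide (j = 0) := fun r hr => by simp [a, hr]
  have ha_odd : ∀ r, ¬Even r → a r = fun j => decide (j = 2) := fun r hr => by simp [a, hr]
  obtain ⟨y, N, hN, hN0, hyB, heq, hneq⟩ := exists_fusion hU rfl hinv hcont hagree
    (fun x y => (hE x y).2) hne a hx₀ (hloc (Sum.inr (Sum.inr c)) x₀ hx₀ hc)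
  have hev : ∀ r, Even (2 * r) := fun r => even_two_mul r
  have hod : ∀ r, ¬Even (2 * r + 1) := fun r => by simp
  refine ⟨c, y 0, hyB 0, y 1, hyB 1, y 2, hyB 2, ?_, ?_, ?_, ?_⟩
  · exact not_e0_of_forall_exists_ne hN fun r => ⟨2 * r, by omega, hneq _ 0 1 (by
      rw [ha_even _ (hev r)]; decide)⟩
  · exact not_e0_of_forall_exists_ne hN fun r => ⟨2 * r, by omega, hneq _ 0 2 (by
      rw [ha_even _ (hev r)]; decide)⟩
  · exact not_e0_of_forall_exists_ne hN fun r => ⟨2 * r + 1, by omega, hneq _ 1 2 (by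
      rw [ha_odd _ (hod r)]; decide)⟩
  · rintro ⟨n, -, h01, h02, h12⟩
    obtain ⟨r, hr, hr'⟩ : ∃ r, N r ≤ n ∧ n < N (r + 1) := by
      have hex : ∃ r, n < N r := ⟨n + 1, Nat.lt_of_succ_le hN.le_apply⟩
      have hpos : Nat.find hex ≠ 0 := fun h0 => by
        have := Nat.find_spec hex
        rw [h0, hN0] at this
        omega
      obtain ⟨r, hr⟩ := Nat.exists_eq_succ_of_ne_zero hpos
      exact ⟨r, not_lt.1 (Nat.find_min hex (by omega)), by
        have := Nat.find_spec hex
        rwa [hr] at this⟩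
    by_cases he : Even r
    · exact h12 (heq r 1 2 (by rw [ha_even r he]; decide) (n + 1) (by omega) hr')
    · exact h01 (heq r 0 1 (by rw [ha_odd r he]; decide) n hr hr'.le)

theorem exists_flipBits_mem_of_mem_satE0 {A : Set (ℕ → Bool)} {x : ℕ → Bool} (h : x ∈ satE0 A) :
    ∃ s, flipBits s x ∈ A := by
  obtain ⟨y, hy, hyx⟩ := h
  obtain ⟨s, rfl⟩ := hyx.symm.exists_flipBits_eq
  exact ⟨s, hy⟩

theorem subset_satE0 (A : Set (ℕ → Bool)) : A ⊆ satE0 A :=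
  fun x hx => ⟨x, hx, 0, fun _ _ => rfl⟩

/-- `E₀` does not have the weak 3-Mycielski property: each `D6 k` is dense open (so
`⋂ k, D6 k` is comeager), yet for all Borel `A₀, A₁, A₂` into which `E₀` Borel-reduces and
which share the same `E₀`-saturation, `A₀ ×_{E₀} A₁ ×_{E₀} A₂ ⊄ ⋂ k, D6 k`. -/
theorem e0_not_weak_three_mycielski :
    (∀ k, IsOpen (D6 k) ∧ Dense (D6 k)) ∧
    (⋂ k, D6 k) ∈ residual ((ℕ → Bool) × (ℕ → Bool) × (ℕ → Bool)) ∧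
    (∀ A0 A1 A2 : Set (ℕ → Bool),
      MeasurableSet A0 → MeasurableSet A1 → MeasurableSet A2 →
      (∃ f : (ℕ → Bool) → (ℕ → Bool),
        Measurable f ∧ range f ⊆ A0 ∧ ∀ x y, E0 x y ↔ E0 (f x) (f y)) →
      (∃ f : (ℕ → Bool) → (ℕ → Bool),
        Measurable f ∧ range f ⊆ A1 ∧ ∀ x y, E0 x y ↔ E0 (f x) (f y)) →
      (∃ f : (ℕ → Bool) → (ℕ → Bool),
        Measurable f ∧ range f ⊆ A2 ∧ ∀ x y, E0 x y ↔ E0 (f x) (f y)) →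
      satE0 A0 = satE0 A1 → satE0 A1 = satE0 A2 →
      ¬prodE0 A0 A1 A2 ⊆ ⋂ k, D6 k) := by
  refine ⟨fun k => ⟨isOpen_D6 k, dense_D6 k⟩,
    countable_iInter_mem.2 fun k => residual_of_dense_open (isOpen_D6 k) (dense_D6 k), ?_⟩
  rintro A0 A1 A2 - hA1 hA2 ⟨f, hf, hfA, hE⟩ - - h01 h12 hsub
  have hfs : ∀ s, Measurable fun x => flipBits s (f x) := fun s =>
    (continuous_flipBits s).measurable.comp hf
  obtain ⟨⟨s, t⟩, x, -, y, hy, z, hz, hxy, hxz, hyz, hD⟩ := exists_triple_notMem_D6 hf hE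
    (fun q : Finset ℕ × Finset ℕ => {x | flipBits q.1 (f x) ∈ A1} ∩ {x | flipBits q.2 (f x) ∈ A2})
    (fun q => (hfs q.1 hA1).inter (hfs q.2 hA2))
    (fun x => by
      have h0 : f x ∈ satE0 A0 := subset_satE0 A0 (hfA (mem_range_self x))
      obtain ⟨s, hs⟩ := exists_flipBits_mem_of_mem_satE0 (h01 ▸ h0)
      obtain ⟨t, ht⟩ := exists_flipBits_mem_of_mem_satE0 (h12 ▸ h01 ▸ h0)
      exact ⟨(s, t), hs, ht⟩)
  obtain ⟨M, hM⟩ := exists_forall_flipBits_eq s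
  obtain ⟨M', hM'⟩ := exists_forall_flipBits_eq t
  have hs := e0_flipBits s (f y)
  have ht := e0_flipBits t (f z)
  have hmem : (f x, flipBits s (f y), flipBits t (f z)) ∈ prodE0 A0 A1 A2 :=
    ⟨hfA (mem_range_self x), hy.1, hz.2, fun h => hxy (h.trans hs), fun h => hxz (h.trans ht),
      fun h => hyz (hs.symm.trans (h.trans ht))⟩
  obtain ⟨n, hn, h1, h2, h3⟩ := mem_iInter.1 (hsub hmem) (max M M')
  have hnM : M ≤ n := (le_max_left _ _).trans hn
  have hnM' : M' ≤ n := (le_max_right _ _).trans hn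
  simp only [hM n hnM, hM (n + 1) (by omega), hM' n hnM', hM' (n + 1) (by omega)] at h1 h2 h3
  exact hD ⟨n, n.zero_le, h1, h2, h3⟩
end
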